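/- Let T¹ ∈ ℝ, and consider on ℝ² the connection with constant Christoffel symbols Γ_{11}¹ = −1, Γ_{12}¹ = 1 + T¹, Γ_{21}¹ = 1 − T¹, Γ_{22}² = 2, and all other Γ_{ij}^k = 0 (the model M₁⁴(T¹,0)). Then a smooth vector field X on ℝ² is an affine Killing vector field for this connection if and only if X lies in the ℝ-linear span of the four vector fields (1,0), (0,1), (e^{x¹}, 0), and (x² e^{x¹}, 0). -/

import Mathlib

open Real

/-- The partial derivative `∂f/∂x^i` of a function on `ℝ²` (points are `Fin 2 → ℝ`). -/
noncomputable def pd (f : (Fin 2 → ℝ) → ℝ) (i : Fin 2) (p : Fin 2 → ℝ) : ℝ :=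
  fderiv ℝ f p (Pi.single i 1)

/-- The affine Killing operator
`K^Γ_{ij}^k(v) = ∂_i∂_j v^k + v^l ∂_l Γ_{ij}^k − Γ_{ij}^l ∂_l v^k + Γ_{il}^k ∂_j v^l + Γ_{lj}^k ∂_i v^l`
(summation over `l`). -/
noncomputable def killingOp (Γ : Fin 2 → Fin 2 → Fin 2 → (Fin 2 → ℝ) → ℝ)
    (v : Fin 2 → (Fin 2 → ℝ) → ℝ) (i j k : Fin 2) (p : Fin 2 → ℝ) : ℝ :=
  pd (fun q => pd (v k) j q) i p
    + (∑ l : Fin 2, v l p * pd (Γ i j k) l p)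
    - (∑ l : Fin 2, Γ i j l p * pd (v k) l p)
    + (∑ l : Fin 2, Γ i l k p * pd (v l) j p)
    + (∑ l : Fin 2, Γ l j k p * pd (v l) i p)

/-- `v` is an affine Killing vector field for the connection `Γ` on `U`:
all eight affine Killing equations hold on `U`. -/
def IsAffineKilling (U : Set (Fin 2 → ℝ))
    (Γ : Fin 2 → Fin 2 → Fin 2 → (Fin 2 → ℝ) → ℝ)
    (v : Fin 2 → (Fin 2 → ℝ) → ℝ) : Prop :=
  ∀ i j k : Fin 2, ∀ p ∈ U, killingOp Γ v i j k p = 0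

/-- The model family `a + (c + d x²) e^{x¹}`, which is closed under partial derivatives. -/
noncomputable def affineExp (a c d : ℝ) (p : Fin 2 → ℝ) : ℝ :=
  a + (c + d * p 1) * Real.exp (p 0)

lemma hasFDerivAt_affineExp (a c d : ℝ) (p : Fin 2 → ℝ) :
    HasFDerivAt (affineExp a c d)
      ((c + d * p 1) • Real.exp (p 0) • ContinuousLinearMap.proj (R := ℝ) (φ := fun _ => ℝ) 0
        + Real.exp (p 0) • d • ContinuousLinearMap.proj (R := ℝ) (φ := fun _ => ℝ) 1) p :=
  ((((hasFDerivAt_apply (𝕜 := ℝ) 1 p).const_mul d).const_add c).mul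
    (hasFDerivAt_apply (𝕜 := ℝ) 0 p).exp).const_add a

lemma pd_affineExp_zero (a c d : ℝ) : pd (affineExp a c d) 0 = affineExp 0 c d := by
  ext p
  simp [pd, (hasFDerivAt_affineExp a c d p).fderiv, affineExp]

lemma pd_affineExp_one (a c d : ℝ) : pd (affineExp a c d) 1 = affineExp 0 d 0 := by
  ext p
  simp [pd, (hasFDerivAt_affineExp a c d p).fderiv, affineExp, mul_comm]

lemma contDiff_affineExp (a c d : ℝ) : ContDiff ℝ (⊤ : ℕ∞) (affineExp a c d) := by
  unfold affineExp
  fun_prop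

lemma pd_const (a : ℝ) (i : Fin 2) : pd (fun _ => a) i = fun _ => 0 := by
  ext p
  simp [pd]

lemma contDiff_pd {f : (Fin 2 → ℝ) → ℝ} (hf : ContDiff ℝ (⊤ : ℕ∞) f) (i : Fin 2) :
    ContDiff ℝ (⊤ : ℕ∞) (pd f i) :=
  (hf.fderiv_right (m := (⊤ : ℕ∞)) (by simp)).clm_apply contDiff_const

lemma pd_comm {f : (Fin 2 → ℝ) → ℝ} (hf : ContDiff ℝ (⊤ : ℕ∞) f) (i j : Fin 2) :
    pd (pd f i) j = pd (pd f j) i := by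
  ext p
  have hd : DifferentiableAt ℝ (fderiv ℝ f) p :=
    ((hf.fderiv_right (m := (⊤ : ℕ∞)) (by simp)).differentiable (by simp)) p
  have key (k l : Fin 2) :
      pd (pd f k) l p = fderiv ℝ (fderiv ℝ f) p (Pi.single l 1) (Pi.single k 1) := by
    have h := hd.hasFDerivAt.clm_apply (hasFDerivAt_const (Pi.single k (1 : ℝ)) p)
    change fderiv ℝ (fun q => fderiv ℝ f q (Pi.single k 1)) p _ = _
    rw [h.fderiv]
    simp
  rw [key, key]
  exact (hf.contDiffAt.isSymmSndFDerivAt (by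
    rw [minSmoothness_of_isRCLikeNormedField]
    exact WithTop.coe_le_coe.2 (le_top : (2 : ℕ∞) ≤ ⊤))).eq _ _

lemma pd_sub {f g : (Fin 2 → ℝ) → ℝ} (hf : Differentiable ℝ f) (hg : Differentiable ℝ g)
    (i : Fin 2) (p : Fin 2 → ℝ) :
    pd (fun q => f q - g q) i p = pd f i p - pd g i p := by
  simp [pd, fderiv_fun_sub (hf p) (hg p)]

lemma pd_mul {f g : (Fin 2 → ℝ) → ℝ} (hf : Differentiable ℝ f) (hg : Differentiable ℝ g)
    (i : Fin 2) (p : Fin 2 → ℝ) :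
    pd (fun q => f q * g q) i p = f p * pd g i p + g p * pd f i p := by
  simp [pd, fderiv_fun_mul (hf p) (hg p)]

lemma exists_eq_const_of_pd_eq_zero {f : (Fin 2 → ℝ) → ℝ} (hf : Differentiable ℝ f)
    (h₀ : ∀ p, pd f 0 p = 0) (h₁ : ∀ p, pd f 1 p = 0) : ∃ a, ∀ p, f p = a := by
  refine ⟨f 0, fun p => is_const_of_fderiv_eq_zero hf (fun q => ?_) p 0⟩
  refine ContinuousLinearMap.coe_injective ((Pi.basisFun ℝ (Fin 2)).ext fun i => ?_)
  fin_cases i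
  · simpa [pd] using h₀ q
  · simpa [pd] using h₁ q

/-- If `∂₁ f = f` and `∂₂ f = d e^{x¹}`, then `f = (c + d x²) e^{x¹}` for some `c`. -/
lemma exists_eq_affineExp {f : (Fin 2 → ℝ) → ℝ} (hf : Differentiable ℝ f) (d : ℝ)
    (h₀ : ∀ p, pd f 0 p = f p) (h₁ : ∀ p, pd f 1 p = affineExp 0 d 0 p) :
    ∃ c, ∀ p, f p = affineExp 0 c d p := by
  have he : Differentiable ℝ fun q : Fin 2 → ℝ => Real.exp (-q 0) := by fun_prop
  have hl : Differentiable ℝ (affineExp 0 0 d) :=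
    (contDiff_affineExp 0 0 d).differentiable (by simp)
  have hg : Differentiable ℝ fun q => f q - affineExp 0 0 d q := hf.sub hl
  have hexp (p : Fin 2 → ℝ) : HasFDerivAt (fun q : Fin 2 → ℝ => Real.exp (-q 0))
      (Real.exp (-p 0) • -ContinuousLinearMap.proj (R := ℝ) (φ := fun _ => ℝ) 0) p :=
    (hasFDerivAt_apply (𝕜 := ℝ) 0 p).neg.exp
  have e₀ (p) : pd (fun q : Fin 2 → ℝ => Real.exp (-q 0)) 0 p = -Real.exp (-p 0) := by
    simp [pd, (hexp p).fderiv]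
  have e₁ (p) : pd (fun q : Fin 2 → ℝ => Real.exp (-q 0)) 1 p = 0 := by
    simp [pd, (hexp p).fderiv]
  obtain ⟨c, hc⟩ := exists_eq_const_of_pd_eq_zero (he.mul hg)
    (fun p => by
      change pd (fun q => Real.exp (-q 0) * (f q - affineExp 0 0 d q)) 0 p = 0
      rw [pd_mul he hg, pd_sub hf hl, e₀, h₀, pd_affineExp_zero]; ring)
    (fun p => by
      change pd (fun q => Real.exp (-q 0) * (f q - affineExp 0 0 d q)) 1 p = 0
      rw [pd_mul he hg, pd_sub hf hl, e₁, h₁, pd_affineExp_one]; ring)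
  refine ⟨c, fun p => ?_⟩
  have h : Real.exp (-p 0) * (f p - affineExp 0 0 d p) = c := hc p
  have hm : Real.exp (p 0) * Real.exp (-p 0) = 1 := by rw [← Real.exp_add]; simp
  unfold affineExp at h ⊢
  linear_combination Real.exp (p 0) * h - (f p - (0 + (0 + d * p 1) * Real.exp (p 0))) * hm

theorem stmt11 (T1 : ℝ)
    (v : Fin 2 → (Fin 2 → ℝ) → ℝ)
    (hv : ∀ i : Fin 2, ContDiff ℝ (⊤ : ℕ∞) (v i)) :
    IsAffineKilling Set.univ
      (fun i j k => fun _ : Fin 2 → ℝ =>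
        ![![![(-1 : ℝ), 0], ![1 + T1, 0]], ![![1 - T1, 0], ![0, 2]]] i j k) v
    ↔ ∃ a b c d : ℝ, ∀ p : Fin 2 → ℝ,
        v 0 p = a + c * Real.exp (p 0) + d * (p 1 * Real.exp (p 0))
        ∧ v 1 p = b := by
  constructor
  · intro h
    have hu := hv 0
    have hw := hv 1
    have E (i j k : Fin 2) (p : Fin 2 → ℝ) := h i j k p trivial
    simp only [killingOp, pd_const, Fin.sum_univ_two] at E
    have u11 (p) : pd (pd (v 0) 0) 0 p = pd (v 0) 0 p - 2 * pd (v 1) 0 p := by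
      have := E 0 0 0 p
      simp at this
      linear_combination this
    have u12 (p) : pd (pd (v 0) 1) 0 p = pd (v 0) 1 p - (1 + T1) * pd (v 1) 1 p := by
      have := E 0 1 0 p
      simp at this
      linear_combination this
    have u21 (p) : pd (pd (v 0) 0) 1 p = pd (v 0) 1 p - (1 - T1) * pd (v 1) 1 p := by
      have := E 1 0 0 p
      simp at this
      linear_combination this
    have u22 (p) : pd (pd (v 0) 1) 1 p = 0 := by
      have := E 1 1 0 p
      simp at this
      linear_combination this
    have w12 (p) : pd (pd (v 1) 1) 0 p = -(1 - T1) * pd (v 1) 0 p := by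
      have := E 0 1 1 p
      simp at this
      linear_combination this
    have w21 (p) : pd (pd (v 1) 0) 1 p = -(1 + T1) * pd (v 1) 0 p := by
      have := E 1 0 1 p
      simp at this
      linear_combination this
    have w22 (p) : pd (pd (v 1) 1) 1 p = -2 * pd (v 1) 1 p := by
      have := E 1 1 1 p
      simp at this
      linear_combination this
    have dif {f : (Fin 2 → ℝ) → ℝ} (hf : ContDiff ℝ (⊤ : ℕ∞) f) : Differentiable ℝ f :=
      hf.differentiable (by simp)
    have w2 (p) : pd (v 1) 1 p = 0 := by
      have hw2 : pd (v 1) 1 = fun q => pd (v 0) 1 q - pd (pd (v 0) 1) 0 q := by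
        ext q
        have hs := congrFun (pd_comm hu 0 1) q
        linear_combination (1 / 2 : ℝ) * u12 q + (1 / 2 : ℝ) * u21 q - (1 / 2 : ℝ) * hs
      have h22 := w22 p
      rw [hw2, pd_sub (dif (contDiff_pd hu 1)) (dif (contDiff_pd (contDiff_pd hu 1) 0)),
        u22, pd_comm (contDiff_pd hu 1), show pd (pd (v 0) 1) 1 = fun _ => 0 from funext u22,
        pd_const] at h22
      rw [hw2]
      linarith
    have w1 (p) : pd (v 1) 0 p = 0 := by
      have hs := congrFun (pd_comm hw 0 1) p
      have h12 := w12 p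
      rw [show pd (v 1) 1 = fun _ => 0 from funext w2, pd_const] at hs h12
      linear_combination (1 / 2 : ℝ) * h12 - (1 / 2 : ℝ) * hs + (1 / 2 : ℝ) * w21 p
    simp only [w1, w2, mul_zero, sub_zero] at u11 u12 u21
    obtain ⟨b, hb⟩ := exists_eq_const_of_pd_eq_zero (dif hw) w1 w2
    obtain ⟨d, hd⟩ := exists_eq_affineExp (dif (contDiff_pd hu 1)) 0 u12
      (fun p => by rw [u22]; simp [affineExp])
    obtain ⟨c, hc⟩ := exists_eq_affineExp (dif (contDiff_pd hu 0)) d u11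
      (fun p => by rw [u21, hd])
    have hu1 := dif (contDiff_pd hu 0)
    obtain ⟨a, ha⟩ := exists_eq_const_of_pd_eq_zero ((dif hu).sub hu1)
      (fun p => (pd_sub (dif hu) hu1 0 p).trans (by rw [u11, sub_self]))
      (fun p => (pd_sub (dif hu) hu1 1 p).trans (by rw [u21, sub_self]))
    refine ⟨a, b, c, d, fun p => ⟨?_, hb p⟩⟩
    have hap : v 0 p - pd (v 0) 0 p = a := ha p
    have hcp := hc p
    unfold affineExp at hcp
    linear_combination hap + hcp
  · rintro ⟨a, b, c, d, h⟩
    have hu : v 0 = affineExp a c d := by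
      ext p
      rw [(h p).1, affineExp]
      ring
    have hw : v 1 = fun _ => b := funext fun p => (h p).2
    intro i j k p _
    fin_cases i <;> fin_cases j <;> fin_cases k <;>
      simp [killingOp, hu, hw, pd_const, pd_affineExp_zero, pd_affineExp_one] <;>
      simp [affineExp] <;> ring
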